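/- Let K be an n×n real symmetric positive definite matrix with eigenvalues λ_1 ≥ … ≥ λ_n > 0 and an orthonormal basis of eigenvectors v_1,…,v_n, let 1 ≤ k ≤ n, and set α = ∑_{i=k}^{n} λ_i. Then the matrix ∑_{C ⊆ {1,…,n}, |C| = k} (det(K_{CC})/e_k(K)) · C K_{CC}^{-1} Cᵀ − ∑_{ℓ=1}^{n} v_ℓ v_ℓᵀ/(λ_ℓ + α) is positive semidefinite; that is, the expectation of C K_{CC}^{-1} Cᵀ over C ~ kDPP(K) dominates ∑_{ℓ=1}^{n} v_ℓ v_ℓᵀ/(λ_ℓ + α) in the Loewner order. -/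

import Mathlib

open Matrix BigOperators Finset

/-- The `n × |C|` sampling matrix obtained by selecting the columns of the identity
matrix indexed by `C`. -/
def sampMatrix {n : ℕ} (C : Finset (Fin n)) : Matrix (Fin n) {x // x ∈ C} ℝ :=
  fun i j => if i = (j : Fin n) then 1 else 0

/-- The principal submatrix `K_{CC}` of `K` with rows and columns indexed by `C`. -/
def principalSub {n : ℕ} (K : Matrix (Fin n) (Fin n) ℝ) (C : Finset (Fin n)) :
    Matrix {x // x ∈ C} {x // x ∈ C} ℝ :=
  fun i j => K i j

/-- `e_k(K)`: the sum of all `k × k` principal minors of `K` (with `e_0(K) = 1`). -/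
noncomputable def esymmMinors {n : ℕ} (K : Matrix (Fin n) (Fin n) ℝ) (k : ℕ) : ℝ :=
  ∑ C ∈ Finset.univ.powersetCard k, (principalSub K C).det

lemma principalSub_eq_submatrix {n : ℕ} (K : Matrix (Fin n) (Fin n) ℝ) (C : Finset (Fin n)) :
    principalSub K C = K.submatrix Subtype.val Subtype.val := rfl

/-- `e_k(AB) = e_k(BA)`, since both are coefficients of `det (1 + X AB) = det (1 + X BA)`. -/
lemma esymmMinors_mul_comm {n : ℕ} (A B : Matrix (Fin n) (Fin n) ℝ) (k : ℕ) :
    esymmMinors (A * B) k = esymmMinors (B * A) k := by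
  simp only [esymmMinors, principalSub_eq_submatrix]
  rw [← coeff_det_one_add_X_smul_eq_sum_minors, ← coeff_det_one_add_X_smul_eq_sum_minors,
    Matrix.map_mul, Matrix.map_mul, ← Matrix.smul_mul, det_one_add_mul_comm, Matrix.mul_smul]

lemma dotProduct_sampMatrix_mulVec {n : ℕ} (C : Finset (Fin n))
    (B : Matrix {i // i ∈ C} {i // i ∈ C} ℝ) (x : Fin n → ℝ) :
    x ⬝ᵥ ((sampMatrix C * B * (sampMatrix C)ᵀ) *ᵥ x) =
      (fun i : {i // i ∈ C} => x i) ⬝ᵥ (B *ᵥ fun i => x i) := by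
  have h : (sampMatrix C)ᵀ *ᵥ x = fun i : {i // i ∈ C} => x i := by
    ext i
    simp [sampMatrix, mulVec, dotProduct]
  rw [← mulVec_mulVec, ← mulVec_mulVec, dotProduct_mulVec, ← mulVec_transpose, h]

/-- The matrix determinant lemma for a symmetric rank-one perturbation. -/
lemma det_add_vecMulVec_self {m : Type*} [Fintype m] [DecidableEq m] {A : Matrix m m ℝ}
    (hA : IsUnit A.det) (x : m → ℝ) :
    (A + vecMulVec x x).det = A.det * (1 + x ⬝ᵥ (A⁻¹ *ᵥ x)) := by
  rw [vecMulVec_eq Unit, det_add_replicateCol_mul_replicateRow hA]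
  congr 1
  rw [det_unique, Matrix.add_apply, one_apply_eq, Matrix.mul_assoc, ← replicateCol_mulVec,
    replicateRow_mul_replicateCol_apply]

/-- `∑ det(K_{CC}) • C K_{CC}⁻¹ Cᵀ`, the kDPP expectation of `C K_{CC}⁻¹ Cᵀ` times `e_k(K)`. -/
noncomputable def sampInvSum {n : ℕ} (K : Matrix (Fin n) (Fin n) ℝ) (k : ℕ) :
    Matrix (Fin n) (Fin n) ℝ :=
  ∑ C ∈ Finset.univ.powersetCard k,
    (principalSub K C).det • (sampMatrix C * (principalSub K C)⁻¹ * (sampMatrix C)ᵀ)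

lemma dotProduct_sampInvSum_mulVec {n : ℕ} (K : Matrix (Fin n) (Fin n) ℝ) (k : ℕ)
    (x : Fin n → ℝ) :
    x ⬝ᵥ (sampInvSum K k *ᵥ x) = ∑ C ∈ Finset.univ.powersetCard k, (principalSub K C).det *
      ((fun i : {i // i ∈ C} => x i) ⬝ᵥ ((principalSub K C)⁻¹ *ᵥ fun i => x i)) := by
  simp only [sampInvSum, sum_mulVec, dotProduct_sum, smul_mulVec, dotProduct_smul, smul_eq_mul,
    dotProduct_sampMatrix_mulVec]

lemma Matrix.PosDef.det_principalSub_pos {n : ℕ} {K : Matrix (Fin n) (Fin n) ℝ} (hK : K.PosDef)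
    (C : Finset (Fin n)) : 0 < (principalSub K C).det :=
  (hK.submatrix Subtype.val_injective).det_pos

lemma Matrix.PosDef.dotProduct_sampInvSum_mulVec {n : ℕ} {K : Matrix (Fin n) (Fin n) ℝ}
    (hK : K.PosDef) (k : ℕ) (x : Fin n → ℝ) :
    x ⬝ᵥ (sampInvSum K k *ᵥ x) = esymmMinors (K + vecMulVec x x) k - esymmMinors K k := by
  rw [_root_.dotProduct_sampInvSum_mulVec, esymmMinors, esymmMinors, ← Finset.sum_sub_distrib]
  refine Finset.sum_congr rfl fun C _ => ?_
  have h : principalSub (K + vecMulVec x x) C =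
      principalSub K C +
        vecMulVec (fun i : {i // i ∈ C} => x i) (fun i : {i // i ∈ C} => x i) := rfl
  rw [h, det_add_vecMulVec_self (hK.det_principalSub_pos C).ne'.isUnit]
  ring

lemma principalSub_diagonal {n : ℕ} (d : Fin n → ℝ) (C : Finset (Fin n)) :
    principalSub (diagonal d) C = diagonal fun i : {i // i ∈ C} => d i :=
  submatrix_diagonal d _ Subtype.val_injective

lemma det_principalSub_diagonal {n : ℕ} (d : Fin n → ℝ) (C : Finset (Fin n)) :
    (principalSub (diagonal d) C).det = ∏ i ∈ C, d i := by
  rw [principalSub_diagonal, det_diagonal, Finset.prod_coe_sort C d]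

lemma dotProduct_sampInvSum_diagonal_mulVec {n : ℕ} {d : Fin n → ℝ} (hd : ∀ i, d i ≠ 0) (k : ℕ)
    (y : Fin n → ℝ) :
    y ⬝ᵥ (sampInvSum (diagonal d) k *ᵥ y) =
      ∑ i, y i ^ 2 * ((∑ C ∈ Finset.univ.powersetCard k with i ∈ C, ∏ j ∈ C, d j) / d i) := by
  have hinv (C : Finset (Fin n)) : (principalSub (diagonal d) C)⁻¹ =
      diagonal fun i : {i // i ∈ C} => (d i)⁻¹ := by
    rw [principalSub_diagonal]
    refine inv_eq_right_inv ?_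
    rw [diagonal_mul_diagonal, ← diagonal_one]
    congr 1
    ext i
    exact mul_inv_cancel₀ (hd i)
  have hquad (C : Finset (Fin n)) : (fun i : {i // i ∈ C} => y i) ⬝ᵥ
      ((principalSub (diagonal d) C)⁻¹ *ᵥ fun i => y i) = ∑ i ∈ C, y i ^ 2 / d i := by
    rw [hinv, ← Finset.sum_coe_sort C]
    refine Finset.sum_congr rfl fun i _ => ?_
    rw [mulVec_diagonal]
    ring
  simp only [dotProduct_sampInvSum_mulVec, hquad, det_principalSub_diagonal, Finset.sum_filter,
    Finset.sum_div, Finset.mul_sum]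
  refine (Finset.sum_congr rfl fun C _ => ?_).trans Finset.sum_comm
  simp only [ite_div, mul_ite, zero_div, mul_zero, Finset.sum_ite_mem, Finset.univ_inter]
  exact Finset.sum_congr rfl fun i _ => by ring

/-- Moving the largest element of `C` out and `i` in compares the `k`-subsets avoiding `i` with
those containing `i`. -/
lemma mul_sum_prod_notMem_le {n : ℕ} {d : Fin n → ℝ} (hd : ∀ i, 0 ≤ d i) {k : ℕ} (hk : 1 ≤ k)
    (i : Fin n) :
    d i * ∑ C ∈ Finset.univ.powersetCard k with i ∉ C, ∏ j ∈ C, d j ≤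
      (∑ j ∈ Finset.univ.filter (fun j : Fin n => k ≤ (j : ℕ) + 1), d j) *
        ∑ C ∈ Finset.univ.powersetCard k with i ∈ C, ∏ j ∈ C, d j := by
  have hne {C : Finset (Fin n)} (hC : C ∈ (Finset.univ.powersetCard k).filter (i ∉ ·)) :
      C.Nonempty := by
    simp only [mem_filter, mem_powersetCard, subset_univ, true_and] at hC
    exact Finset.card_pos.mp (by omega)
  let f (C : Finset (Fin n)) (hC : C ∈ (Finset.univ.powersetCard k).filter (i ∉ ·)) :
      Fin n × Finset (Fin n) :=
    (C.max' (hne hC), insert i (C.erase (C.max' (hne hC))))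
  rw [Finset.sum_mul_sum, ← Finset.sum_product', Finset.mul_sum]
  refine (Finset.sum_attach _ _).symm.trans_le ?_
  have hinj : Function.Injective
      fun C : {C // C ∈ (Finset.univ.powersetCard k).filter (i ∉ ·)} => f C.1 C.2 := by
    rintro ⟨C, hC⟩ ⟨D, hD⟩ h
    obtain ⟨hmax, hins⟩ := Prod.mk.inj h
    have hiC : i ∉ C := (mem_filter.mp hC).2
    have hiD : i ∉ D := (mem_filter.mp hD).2
    have := congrArg (fun s => Finset.erase s i) hins
    simp only [Finset.erase_insert (fun h => hiC (Finset.mem_of_mem_erase h)),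
      Finset.erase_insert (fun h => hiD (Finset.mem_of_mem_erase h))] at this
    refine Subtype.ext ?_
    change C = D
    rw [← Finset.insert_erase (C.max'_mem (hne hC)), this, hmax,
      Finset.insert_erase (D.max'_mem (hne hD))]
  calc _ = ∑ C ∈ Finset.attach ((Finset.univ.powersetCard k).filter (i ∉ ·)),
        d (f C.1 C.2).1 * ∏ j ∈ (f C.1 C.2).2, d j := by
        refine Finset.sum_congr rfl fun ⟨C, hC⟩ _ => ?_
        have hi : i ∉ C := (mem_filter.mp hC).2
        dsimp only [f]
        rw [Finset.prod_insert (fun h => hi (Finset.mem_of_mem_erase h)), mul_left_comm,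
          Finset.mul_prod_erase C d (C.max'_mem (hne hC))]
    _ = ∑ p ∈ (Finset.attach ((Finset.univ.powersetCard k).filter (i ∉ ·))).image
          (fun C => f C.1 C.2), d p.1 * ∏ j ∈ p.2, d j :=
        (Finset.sum_image (f := fun p : Fin n × Finset (Fin n) => d p.1 * ∏ j ∈ p.2, d j)
          hinj.injOn).symm
    _ ≤ _ := by
        refine Finset.sum_le_sum_of_subset_of_nonneg ?_
          fun p _ _ => mul_nonneg (hd _) (Finset.prod_nonneg fun j _ => hd j)
        intro p hp
        obtain ⟨⟨C, hC⟩, -, rfl⟩ := Finset.mem_image.mp hp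
        have hC' := hC
        simp only [mem_filter, mem_powersetCard, subset_univ, true_and] at hC'
        have hle : C ⊆ Finset.Iic (C.max' (hne hC)) :=
          fun j hj => Finset.mem_Iic.mpr (C.le_max' j hj)
        have hcard := Finset.card_le_card hle
        rw [Fin.card_Iic, hC'.1] at hcard
        simp only [f, mem_product, mem_filter, mem_univ, true_and, mem_powersetCard, subset_univ,
          mem_insert_self, and_true]
        refine ⟨hcard, ?_⟩
        rw [Finset.card_insert_of_notMem (fun h => hC'.2 (Finset.mem_of_mem_erase h)),
          Finset.card_erase_of_mem (C.max'_mem (hne hC)), hC'.1]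
        omega

/-- Loewner lower bound for the kDPP expectation: with `α = ∑_{i=k}^{n} λ_i`
(the `λ_i` being the decreasingly ordered eigenvalues of `K`),
`E_{C ~ kDPP(K)}[C K_{CC}⁻¹ Cᵀ] ⪰ ∑ ℓ, v_ℓ v_ℓᵀ/(λ_ℓ + α)`.
(Indices are 0-based in the formalization, so `∑_{i=k}^{n} λ_i` becomes the sum over
indices `i` with `k ≤ i + 1`.) -/
theorem kdpp_expectation_loewner_lower_bound (n : ℕ) (K : Matrix (Fin n) (Fin n) ℝ)
    (hsymm : K.IsSymm) (hPD : K.PosDef) (lam : Fin n → ℝ) (v : Fin n → Fin n → ℝ)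
    (hpos : ∀ i, 0 < lam i)
    (hsort : ∀ i j : Fin n, i ≤ j → lam j ≤ lam i)
    (hortho : ∀ i j, v i ⬝ᵥ v j = if i = j then (1 : ℝ) else 0)
    (hK : K = ∑ ℓ, lam ℓ • vecMulVec (v ℓ) (v ℓ))
    (k : ℕ) (hk1 : 1 ≤ k) (hkn : k ≤ n)
    (α : ℝ) (hα : α = ∑ i ∈ Finset.univ.filter (fun i : Fin n => k ≤ (i : ℕ) + 1), lam i) :
    (∑ C ∈ Finset.univ.powersetCard k,
        ((principalSub K C).det / esymmMinors K k) •
          (sampMatrix C * (principalSub K C)⁻¹ * (sampMatrix C)ᵀ)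
      - ∑ ℓ, (lam ℓ + α)⁻¹ • vecMulVec (v ℓ) (v ℓ)).PosSemidef := by
  have he : 0 < esymmMinors K k :=
    Finset.sum_pos (fun C _ => hPD.det_principalSub_pos C)
      (Finset.powersetCard_nonempty.mpr (by simpa using hkn))
  have hα0 : 0 ≤ α := hα ▸ Finset.sum_nonneg fun i _ => (hpos i).le
  let V : Matrix (Fin n) (Fin n) ℝ := of v
  have hV : V * Vᵀ = 1 := by
    ext i j
    rw [one_apply, ← hortho i j]
    rfl
  have hV' : Vᵀ * V = 1 := mul_eq_one_comm.mp hV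
  have hKV : K = Vᵀ * (diagonal lam * V) := by
    rw [hK]
    ext i j
    rw [Matrix.sum_apply, Matrix.mul_apply]
    simp only [Matrix.smul_apply, vecMulVec_apply, diagonal_mul, transpose_apply, smul_eq_mul, V,
      of_apply]
    exact Finset.sum_congr rfl fun l _ => by ring
  have hconj (D : Matrix (Fin n) (Fin n) ℝ) :
      esymmMinors (Vᵀ * (D * V)) k = esymmMinors D k := by
    rw [esymmMinors_mul_comm, Matrix.mul_assoc, hV, Matrix.mul_one]
  have heD : esymmMinors K k = ∑ C ∈ Finset.univ.powersetCard k, ∏ j ∈ C, lam j := by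
    rw [hKV, hconj]
    exact Finset.sum_congr rfl fun C _ => det_principalSub_diagonal lam C
  have hquad (x : Fin n → ℝ) : x ⬝ᵥ (sampInvSum K k *ᵥ x) =
      (V *ᵥ x) ⬝ᵥ (sampInvSum (diagonal lam) k *ᵥ (V *ᵥ x)) := by
    have hx : K + vecMulVec x x =
        Vᵀ * ((diagonal lam + vecMulVec (V *ᵥ x) (V *ᵥ x)) * V) := by
      rw [Matrix.add_mul, Matrix.mul_add, ← hKV, vecMulVec_mul, mul_vecMulVec, mulVec_mulVec,
        hV', one_mulVec, ← mulVec_transpose, mulVec_mulVec, hV', one_mulVec]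
    rw [hPD.dotProduct_sampInvSum_mulVec, hx, hconj,
      (PosDef.diagonal hpos).dotProduct_sampInvSum_mulVec]
    congr 1
    rw [hKV, hconj]
  have hE : ∑ C ∈ Finset.univ.powersetCard k, ((principalSub K C).det / esymmMinors K k) •
      (sampMatrix C * (principalSub K C)⁻¹ * (sampMatrix C)ᵀ) =
      (esymmMinors K k)⁻¹ • sampInvSum K k := by
    simp only [sampInvSum, Finset.smul_sum, smul_smul, div_eq_inv_mul]
  rw [hE]
  refine PosSemidef.of_dotProduct_mulVec_nonneg (IsHermitian.sub ?_ ?_) fun x => ?_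
  · refine (PosSemidef.smul (posSemidef_sum _ fun C _ => ?_) (inv_nonneg.mpr he.le)).isHermitian
    exact ((hPD.submatrix Subtype.val_injective).inv.posSemidef.mul_mul_conjTranspose_same
      (sampMatrix C)).smul (hPD.det_principalSub_pos C).le
  · exact (posSemidef_sum _ fun l _ => (posSemidef_vecMulVec_self_star (v l)).smul
      (inv_nonneg.mpr (add_nonneg (hpos l).le hα0))).isHermitian
  · have hv : x ⬝ᵥ ((∑ l, (lam l + α)⁻¹ • vecMulVec (v l) (v l)) *ᵥ x) =
        ∑ l, (V *ᵥ x) l ^ 2 * (lam l + α)⁻¹ := by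
      simp only [sum_mulVec, dotProduct_sum, smul_mulVec, dotProduct_smul, vecMulVec_mulVec]
      refine Finset.sum_congr rfl fun l _ => ?_
      have : (V *ᵥ x) l = v l ⬝ᵥ x := rfl
      rw [this]
      simp [dotProduct_comm x]
      ring
    rw [star_trivial, sub_mulVec, dotProduct_sub, smul_mulVec, dotProduct_smul, hquad,
      dotProduct_sampInvSum_diagonal_mulVec (fun i => (hpos i).ne'), hv, sub_nonneg, smul_eq_mul,
      Finset.mul_sum]
    refine Finset.sum_le_sum fun l _ => ?_
    have hcomb := mul_sum_prod_notMem_le (fun i => (hpos i).le) hk1 l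
    rw [← hα] at hcomb
    have hsplit := Finset.sum_filter_add_sum_filter_not (Finset.univ.powersetCard k) (l ∈ ·)
      (fun C => ∏ j ∈ C, lam j)
    rw [← heD] at hsplit
    rw [mul_left_comm]
    refine mul_le_mul_of_nonneg_left ?_ (sq_nonneg _)
    have hl := hpos l
    rw [inv_mul_eq_div, div_div, inv_eq_one_div, div_le_div_iff₀ (by positivity) (by positivity)]
    linear_combination hcomb - lam l * hsplit
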